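/- Let u be a C² function on the closed unit disk B₁ ⊂ ℝ² satisfying Δu = V e^u in B₁ with 0 ≤ V ≤ λ. Then (∫_{∂B₁} e^{u/2} dσ)² ≥ (4π − (λ/2) ∫_{B₁} e^u dx) · ∫_{B₁} e^u dx. -/

import Mathlib

open MeasureTheory Complex Real

/-- Planar Laplacian of a real-valued function on `ℂ ≅ ℝ²`. -/
noncomputable def lap2 (u : ℂ → ℝ) (z : ℂ) : ℝ :=
  fderiv ℝ (fun w => fderiv ℝ u w 1) z 1 +
    fderiv ℝ (fun w => fderiv ℝ u w Complex.I) z Complex.I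

theorem exists_differentiable_re_approx {u : ℂ → ℝ} (hu : ContinuousOn u (Metric.sphere 0 1))
    {ε : ℝ} (hε : 0 < ε) :
    ∃ F : ℂ → ℂ, Differentiable ℂ F ∧ ∀ z ∈ Metric.sphere (0 : ℂ) 1, |u z - (F z).re| < ε := by
  have : Fact (0 < 2 * π) := ⟨Real.two_pi_pos⟩
  let f : C(AddCircle (2 * π), ℂ) :=
    { toFun := fun x => ((u (x.toCircle : ℂ) : ℝ) : ℂ)
      continuous_toFun := by
        refine Complex.continuous_ofReal.comp (hu.comp_continuous ?_ fun x => ?_)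
        · exact continuous_subtype_val.comp AddCircle.continuous_toCircle
        · simp only [mem_sphere_zero_iff_norm, Circle.norm_coe] }
  have hf : f ∈ (Submodule.span ℂ (Set.range (fourier (T := 2 * π)))).topologicalClosure := by
    rw [span_fourier_closure_eq_top]; trivial
  rw [← SetLike.mem_coe, Submodule.topologicalClosure_coe, Metric.mem_closure_iff] at hf
  obtain ⟨q, hq, hqf⟩ := hf ε hε
  have key : ∃ P Q : ℂ → ℂ, Differentiable ℂ P ∧ Differentiable ℂ Q ∧
      ∀ x : AddCircle (2 * π), q x = P x.toCircle + (starRingEnd ℂ) (Q x.toCircle) := by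
    clear hqf
    induction hq using Submodule.span_induction with
    | mem q hq =>
      obtain ⟨n, rfl⟩ := hq
      obtain ⟨k, rfl | rfl⟩ := n.eq_nat_or_neg
      · exact ⟨fun z => z ^ k, 0, by fun_prop, differentiable_const 0, fun x => by
          simp [AddCircle.toCircle_nsmul]⟩
      · exact ⟨0, fun z => z ^ k, differentiable_const 0, by fun_prop, fun x => by
          simp [AddCircle.toCircle_nsmul, AddCircle.toCircle_neg, ← Circle.coe_inv_eq_conj]⟩
    | zero => exact ⟨0, 0, differentiable_const 0, differentiable_const 0, by simp⟩
    | add a b _ _ ha hb =>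
      obtain ⟨P, Q, hP, hQ, h⟩ := ha
      obtain ⟨P', Q', hP', hQ', h'⟩ := hb
      exact ⟨P + P', Q + Q', hP.add hP', hQ.add hQ', fun x => by simp [h, h']; ring⟩
    | smul c a _ ha =>
      obtain ⟨P, Q, hP, hQ, h⟩ := ha
      exact ⟨fun z => c * P z, fun z => (starRingEnd ℂ) c * Q z, hP.const_mul _, hQ.const_mul _,
        fun x => by simp [h]; ring⟩
  obtain ⟨P, Q, hP, hQ, h⟩ := key
  refine ⟨P + Q, hP.add hQ, fun z hz => ?_⟩
  obtain ⟨x, hx⟩ := (AddCircle.homeomorphCircle (T := 2 * π) (by positivity)).surjective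
    (⟨z, by simpa [Submonoid.unitSphere] using hz⟩ : Circle)
  have hxz : (x.toCircle : ℂ) = z := by
    rw [AddCircle.homeomorphCircle_apply] at hx
    rw [hx]
  have h1 : ‖f x - q x‖ < ε := by
    rw [← dist_eq_norm]; exact (ContinuousMap.dist_apply_le_dist x).trans_lt hqf
  refine lt_of_le_of_lt ?_ h1
  have h2 := Complex.abs_re_le_norm (f x - q x)
  simpa [f, h, hxz] using h2

theorem ContDiffAt.fderiv_fderiv_apply {E F : Type*} [NormedAddCommGroup E] [NormedSpace ℝ E]
    [NormedAddCommGroup F] [NormedSpace ℝ F] {w : E → F} {z : E} (hw : ContDiffAt ℝ 2 w z) (e : E) :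
    fderiv ℝ (fun x => fderiv ℝ w x e) z e = iteratedFDeriv ℝ 2 w z ![e, e] := by
  have h : DifferentiableAt ℝ (fderiv ℝ w) z :=
    (hw.fderiv_right (m := 1) (by norm_num)).differentiableAt (by norm_num)
  rw [iteratedFDeriv_two_apply, fderiv_clm_apply h (differentiableAt_const e)]
  simp

theorem ContDiffAt.lap2_eq_laplacian {w : ℂ → ℝ} {z : ℂ} (hw : ContDiffAt ℝ 2 w z) :
    lap2 w z = Laplacian.laplacian w z := by
  rw [InnerProductSpace.laplacian_eq_iteratedFDeriv_complexPlane]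
  simp only [lap2, hw.fderiv_fderiv_apply]

theorem IsLocalMax.iteratedFDeriv_two_nonpos {E : Type*} [NormedAddCommGroup E] [NormedSpace ℝ E]
    {w : E → ℝ} {z : E} (hmax : IsLocalMax w z) (hw : ContDiffAt ℝ 2 w z) (e : E) :
    iteratedFDeriv ℝ 2 w z ![e, e] ≤ 0 := by
  rw [← hw.fderiv_fderiv_apply]
  by_contra! hpos
  let γ : ℝ → E := fun t => z + t • e
  have hγ0 : γ 0 = z := by simp [γ]
  have hγ : ∀ t, HasDerivAt γ e t := fun t => by
    simpa [γ] using ((hasDerivAt_id t).smul_const e).const_add z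
  have hγc : Filter.Tendsto γ (nhds 0) (nhds z) := by
    simpa only [hγ0] using (hγ 0).continuousAt.tendsto
  have hd : ∀ᶠ t in nhds (0 : ℝ), deriv (w ∘ γ) t = fderiv ℝ w (γ t) e := by
    have : ∀ᶠ x in nhds z, DifferentiableAt ℝ w x :=
      (hw.eventually (by simp)).mono fun x hx => hx.differentiableAt (by norm_num)
    filter_upwards [hγc.eventually this] with t ht
    exact (ht.hasFDerivAt.comp_hasDerivAt t (hγ t)).deriv
  have hdd : deriv (deriv (w ∘ γ)) 0 = fderiv ℝ (fun x => fderiv ℝ w x e) z e := by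
    rw [Filter.EventuallyEq.deriv_eq hd]
    have h : DifferentiableAt ℝ (fun x => fderiv ℝ w x e) (γ 0) := by
      rw [hγ0]
      exact ((hw.fderiv_right (m := 1) (by norm_num)).differentiableAt (by norm_num)).clm_apply
        (differentiableAt_const e)
    have := (h.hasFDerivAt.comp_hasDerivAt 0 (hγ 0)).deriv
    rw [hγ0] at this
    exact this
  have hlmax : IsLocalMax (w ∘ γ) 0 := by
    have := hγc.eventually hmax
    simpa [IsLocalMax, IsMaxFilter, hγ0] using this
  have hlmin : IsLocalMin (w ∘ γ) 0 := by
    refine isLocalMin_of_deriv_deriv_pos (by rwa [hdd]) hlmax.deriv_eq_zero ?_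
    exact ContinuousAt.comp (by rw [hγ0]; exact hw.continuousAt) (hγ 0).continuousAt
  have hconst : (w ∘ γ) =ᶠ[nhds 0] fun _ => (w ∘ γ) 0 := by
    filter_upwards [hlmax, hlmin] with t h1 h2 using le_antisymm h1 h2
  have : deriv (deriv (w ∘ γ)) 0 = 0 := by
    rw [hconst.deriv.deriv_eq]; simp
  rw [hdd] at this
  exact hpos.ne' this

theorem laplacian_norm_sq_complex (z : ℂ) :
    Laplacian.laplacian (fun z : ℂ => ‖z‖ ^ 2) z = 4 := by
  obtain ⟨T, hT⟩ : ∃ T : ℂ →L[ℝ] ℂ →L[ℝ] ℝ, ∀ x y, T x y = 2 * inner ℝ x y :=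
    ⟨(2 : ℝ) • innerSL ℝ, fun x y => rfl⟩
  have h : fderiv ℝ (fun z : ℂ => ‖z‖ ^ 2) = fun x => T x := by
    ext x y
    rw [(hasStrictFDerivAt_norm_sq x).hasFDerivAt.fderiv, hT]
    simp [two_mul]
    ring
  rw [InnerProductSpace.laplacian_eq_iteratedFDeriv_complexPlane]
  simp only [iteratedFDeriv_two_apply, h, T.fderiv, hT]
  simp
  norm_num

/-- The weak maximum principle for subharmonic functions on the unit disk. -/
theorem nonpos_of_laplacian_nonneg {w : ℂ → ℝ} (hc : ContinuousOn w (Metric.closedBall 0 1))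
    (hw : ∀ z ∈ Metric.ball (0 : ℂ) 1, ContDiffAt ℝ 2 w z)
    (hL : ∀ z ∈ Metric.ball (0 : ℂ) 1, 0 ≤ Laplacian.laplacian w z)
    (hb : ∀ z ∈ Metric.sphere (0 : ℂ) 1, w z ≤ 0) :
    ∀ z ∈ Metric.closedBall (0 : ℂ) 1, w z ≤ 0 := by
  intro z hz
  refine le_of_forall_pos_le_add fun ε hε => ?_
  rw [zero_add]
  let s : ℂ → ℝ := fun z => ‖z‖ ^ 2
  have hs : ContDiff ℝ 2 s := contDiff_norm_sq ℝ
  obtain ⟨z₀, hz₀, hmax⟩ := (isCompact_closedBall (0 : ℂ) 1).exists_isMaxOn ⟨z, hz⟩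
    (hc.add (hs.continuous.const_smul ε).continuousOn)
  have hz₀' : z₀ ∈ Metric.sphere (0 : ℂ) 1 := by
    by_contra hns
    have hball : z₀ ∈ Metric.ball (0 : ℂ) 1 := by
      rw [mem_sphere_zero_iff_norm] at hns
      rw [mem_closedBall_zero_iff] at hz₀
      rw [mem_ball_zero_iff]
      exact lt_of_le_of_ne hz₀ hns
    have hsε : ContDiffAt ℝ 2 (ε • s) z₀ := hs.contDiffAt.const_smul ε
    have hlm : IsLocalMax (w + ε • s) z₀ :=
      hmax.isLocalMax (Filter.mem_of_superset (Metric.isOpen_ball.mem_nhds hball)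
        Metric.ball_subset_closedBall)
    have hcd : ContDiffAt ℝ 2 (w + ε • s) z₀ := (hw z₀ hball).add hsε
    have h1 := hlm.iteratedFDeriv_two_nonpos hcd 1
    have h2 := hlm.iteratedFDeriv_two_nonpos hcd Complex.I
    have h3 : Laplacian.laplacian (w + ε • s) z₀ ≤ 0 := by
      rw [InnerProductSpace.laplacian_eq_iteratedFDeriv_complexPlane]
      exact add_nonpos h1 h2
    rw [(hw z₀ hball).laplacian_add hsε, InnerProductSpace.laplacian_smul ε hs.contDiffAt,
      laplacian_norm_sq_complex, smul_eq_mul] at h3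
    linarith [hL z₀ hball]
  have h : w z + ε * ‖z‖ ^ 2 ≤ w z₀ + ε * ‖z₀‖ ^ 2 := hmax hz
  have h0 : ‖z₀‖ = 1 := by simpa using hz₀'
  rw [h0] at h
  have := hb z₀ hz₀'
  have : 0 ≤ ε * ‖z‖ ^ 2 := by positivity
  linarith

theorem Polynomial.integral_norm_sq_circle (p : Polynomial ℂ) {N : ℕ} (hN : p.natDegree < N) :
    ∫ θ in (0 : ℝ)..(2 * π), ‖p.eval (Complex.exp (θ * Complex.I))‖ ^ 2 =
      2 * π * ∑ i ∈ Finset.range N, ‖p.coeff i‖ ^ 2 := by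
  have h := p.sum_sq_norm_coeff_eq_circleAverage
  have h1 : ∑ i ∈ p.support, ‖p.coeff i‖ ^ 2 = ∑ i ∈ Finset.range N, ‖p.coeff i‖ ^ 2 := by
    refine Finset.sum_subset (fun i hi => ?_) fun i _ hi => ?_
    · exact Finset.mem_range.2 ((Polynomial.le_natDegree_of_mem_supp i hi).trans_lt hN)
    · simp [Polynomial.notMem_support_iff.1 hi]
  rw [← h1, h, Real.circleAverage_def]
  simp only [circleMap, Complex.ofReal_one, one_mul, zero_add, smul_eq_mul]
  rw [mul_inv_cancel_left₀ (by positivity)]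

theorem Polynomial.integral_norm_sq_circle_radius (p : Polynomial ℂ) {N : ℕ}
    (hN : p.natDegree < N) (r : ℝ) :
    ∫ θ in (-π)..π, ‖p.eval (r * Complex.exp (θ * Complex.I))‖ ^ 2 =
      2 * π * ∑ i ∈ Finset.range N, ‖p.coeff i‖ ^ 2 * r ^ (2 * i) := by
  let q := p.comp (Polynomial.C (r : ℂ) * Polynomial.X)
  have hq : q.natDegree < N := by
    refine lt_of_le_of_lt ?_ hN
    refine Polynomial.natDegree_comp_le.trans ?_
    exact (Nat.mul_le_mul_left _ (Polynomial.natDegree_C_mul_le _ _)).trans (by simp)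
  have h := q.integral_norm_sq_circle hq
  have hper : Function.Periodic
      (fun θ : ℝ => ‖p.eval (r * Complex.exp (θ * Complex.I))‖ ^ 2) (2 * π) := fun θ => by
    have : Complex.exp (((θ + 2 * π : ℝ) : ℂ) * Complex.I) = Complex.exp (θ * Complex.I) := by
      push_cast
      rw [add_mul, Complex.exp_add, Complex.exp_two_pi_mul_I, mul_one]
    simp only [this]
  have h2 := hper.intervalIntegral_add_eq (-π) 0
  rw [show -π + 2 * π = π by ring, zero_add] at h2
  rw [h2]
  simp only [q, Polynomial.eval_comp, Polynomial.eval_mul, Polynomial.eval_C, Polynomial.eval_X,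
    Polynomial.comp_C_mul_X_coeff] at h
  rw [h]
  congr 1
  refine Finset.sum_congr rfl fun i _ => ?_
  rw [norm_mul, norm_pow, Complex.norm_real, mul_pow, ← pow_mul, mul_comm i 2,
    Real.norm_eq_abs, (even_two_mul i).pow_abs]

theorem setIntegral_ball_eq_polar {f : ℂ → ℝ} (hf : Continuous f) :
    ∫ z in Metric.ball (0 : ℂ) 1, f z =
      ∫ r in (0 : ℝ)..1, r * ∫ θ in (-π)..π, f (r * Complex.exp (θ * Complex.I)) := by
  have hexp : ∀ p : ℝ × ℝ, Complex.polarCoord.symm p = p.1 * Complex.exp (p.2 * Complex.I) :=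
    fun p => by rw [Complex.polarCoord_symm_apply, Complex.exp_mul_I]; simp
  have hcont : Continuous fun p : ℝ × ℝ => p.1 * f (p.1 * Complex.exp (p.2 * Complex.I)) := by
    fun_prop
  rw [← integral_indicator measurableSet_ball, ← Complex.integral_comp_polarCoord_symm]
  have h1 : ∫ p in polarCoord.target,
      p.1 • (Metric.ball (0 : ℂ) 1).indicator f (Complex.polarCoord.symm p) =
      ∫ p in polarCoord.target, (Set.Ioo (0 : ℝ) 1 ×ˢ Set.Ioo (-π) π).indicator
        (fun p : ℝ × ℝ => p.1 * f (p.1 * Complex.exp (p.2 * Complex.I))) p := by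
    refine setIntegral_congr_fun polarCoord.open_target.measurableSet fun p hp => ?_
    have hp' : 0 < p.1 ∧ p.2 ∈ Set.Ioo (-π) π := by simpa [polarCoord_target] using hp
    have hiff : Complex.polarCoord.symm p ∈ Metric.ball (0 : ℂ) 1 ↔
        p ∈ Set.Ioo (0 : ℝ) 1 ×ˢ Set.Ioo (-π) π := by
      rw [mem_ball_zero_iff, Complex.norm_polarCoord_symm, abs_of_pos hp'.1]
      exact ⟨fun h => ⟨⟨hp'.1, h⟩, hp'.2⟩, fun h => h.1.2⟩
    by_cases h : p ∈ Set.Ioo (0 : ℝ) 1 ×ˢ Set.Ioo (-π) π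
    · rw [Set.indicator_of_mem h, Set.indicator_of_mem (hiff.2 h), smul_eq_mul, hexp]
    · simp only [Set.indicator_of_notMem h, Set.indicator_of_notMem (fun h' => h (hiff.1 h')),
        smul_zero]
  rw [h1, setIntegral_indicator (measurableSet_Ioo.prod measurableSet_Ioo)]
  have h2 : polarCoord.target ∩ Set.Ioo (0 : ℝ) 1 ×ˢ Set.Ioo (-π) π =
      Set.Ioo (0 : ℝ) 1 ×ˢ Set.Ioo (-π) π := by
    refine Set.inter_eq_right.2 fun p hp => ?_
    rw [polarCoord_target]
    exact ⟨hp.1.1, hp.2⟩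
  rw [h2, Measure.volume_eq_prod, setIntegral_prod]
  · rw [intervalIntegral.integral_of_le zero_le_one, integral_Ioc_eq_integral_Ioo]
    refine setIntegral_congr_fun measurableSet_Ioo fun r _ => ?_
    simp only
    rw [intervalIntegral.integral_of_le (by linarith [Real.pi_pos]), integral_Ioc_eq_integral_Ioo,
      integral_const_mul]
  · refine (hcont.continuousOn.integrableOn_compact
      (isCompact_Icc.prod isCompact_Icc)).mono_set
      (Set.prod_mono Set.Ioo_subset_Icc_self Set.Ioo_subset_Icc_self)

theorem Polynomial.integral_norm_sq_ball (p : Polynomial ℂ) {N : ℕ} (hN : p.natDegree < N) :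
    ∫ z in Metric.ball (0 : ℂ) 1, ‖p.eval z‖ ^ 2 =
      π * ∑ i ∈ Finset.range N, ‖p.coeff i‖ ^ 2 / (i + 1) := by
  rw [setIntegral_ball_eq_polar (by fun_prop)]
  simp only [p.integral_norm_sq_circle_radius hN]
  have h : ∀ r : ℝ, r * (2 * π * ∑ i ∈ Finset.range N, ‖p.coeff i‖ ^ 2 * r ^ (2 * i)) =
      ∑ i ∈ Finset.range N, 2 * π * ‖p.coeff i‖ ^ 2 * r ^ (2 * i + 1) := fun r => by
    simp only [Finset.mul_sum]
    exact Finset.sum_congr rfl fun i _ => by ring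
  simp only [h]
  rw [intervalIntegral.integral_finsetSum
    fun i _ => Continuous.intervalIntegrable (by fun_prop) _ _, Finset.mul_sum]
  refine Finset.sum_congr rfl fun i _ => ?_
  rw [intervalIntegral.integral_const_mul, integral_pow]
  have : (i : ℝ) + 1 ≠ 0 := by positivity
  push_cast
  rw [show (2 * (i : ℝ) + 1 + 1) = 2 * (i + 1) by ring]
  simp
  field_simp

theorem sum_range_sum_antidiagonal_le_sq {A : ℕ → ℝ} (hA : ∀ i, 0 ≤ A i) (N : ℕ) :
    ∑ n ∈ Finset.range N, ∑ x ∈ Finset.HasAntidiagonal.antidiagonal n, A x.1 * A x.2 ≤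
      (∑ i ∈ Finset.range N, A i) ^ 2 := by
  rw [sq, Finset.sum_mul_sum, ← Finset.sum_product', ← Finset.sum_biUnion]
  · refine Finset.sum_le_sum_of_subset_of_nonneg (fun x hx => ?_)
      fun x _ _ => mul_nonneg (hA _) (hA _)
    simp only [Finset.mem_biUnion, Finset.mem_range, Finset.HasAntidiagonal.mem_antidiagonal,
      Finset.mem_product] at hx ⊢
    omega
  · intro m _ n _ hmn
    refine Finset.disjoint_left.2 fun x hx hx' => hmn ?_
    rw [Finset.HasAntidiagonal.mem_antidiagonal] at hx hx'
    omega

/-- **Carleman's inequality** for the square of a polynomial. -/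
theorem Polynomial.carleman (p : Polynomial ℂ) :
    4 * π * ∫ z in Metric.ball (0 : ℂ) 1, ‖p.eval z‖ ^ 4 ≤
      (∫ θ in (0 : ℝ)..(2 * π), ‖p.eval (Complex.exp (θ * Complex.I))‖ ^ 2) ^ 2 := by
  let N := (p ^ 2).natDegree + p.natDegree + 1
  have h4 : ∀ z, ‖p.eval z‖ ^ 4 = ‖(p ^ 2).eval z‖ ^ 2 := fun z => by
    rw [Polynomial.eval_pow, norm_pow, ← pow_mul]
  simp only [h4]
  rw [(p ^ 2).integral_norm_sq_ball (N := N) (by omega),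
    p.integral_norm_sq_circle (N := N) (by omega)]
  have hcoeff : ∀ n : ℕ, ‖(p ^ 2).coeff n‖ ^ 2 / (n + 1) ≤
      ∑ x ∈ Finset.HasAntidiagonal.antidiagonal n, ‖p.coeff x.1‖ ^ 2 * ‖p.coeff x.2‖ ^ 2 := fun n => by
    rw [div_le_iff₀ (by positivity), sq p, Polynomial.coeff_mul]
    calc ‖∑ x ∈ Finset.HasAntidiagonal.antidiagonal n, p.coeff x.1 * p.coeff x.2‖ ^ 2
        ≤ (∑ x ∈ Finset.HasAntidiagonal.antidiagonal n, ‖p.coeff x.1 * p.coeff x.2‖) ^ 2 := by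
          gcongr; exact norm_sum_le _ _
      _ ≤ _ := sq_sum_le_card_mul_sum_sq
      _ = _ := by simp [mul_pow, mul_comm]
  have := (Finset.sum_le_sum fun n (_ : n ∈ Finset.range N) => hcoeff n).trans
    (sum_range_sum_antidiagonal_le_sq (A := fun i => ‖p.coeff i‖ ^ 2) (fun i => by positivity) N)
  rw [mul_pow]
  calc _ = (2 * π) ^ 2 * ∑ n ∈ Finset.range N, ‖(p ^ 2).coeff n‖ ^ 2 / (n + 1) := by ring
    _ ≤ _ := by gcongr

theorem Differentiable.exists_polynomial_approx {g : ℂ → ℂ} (hg : Differentiable ℂ g) {δ : ℝ}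
    (hδ : 0 < δ) :
    ∃ p : Polynomial ℂ, ∀ z ∈ Metric.closedBall (0 : ℂ) 1, ‖p.eval z - g z‖ < δ := by
  have hs := (hg.differentiableOn (s := Metric.closedBall 0 ((3 : NNReal) : ℝ))).hasFPowerSeriesOnBall
    (by norm_num)
  have hu := hs.tendstoUniformlyOn (r' := 2) (by norm_num)
  rw [Metric.tendstoUniformlyOn_iff] at hu
  obtain ⟨n, hn⟩ := (hu δ hδ).exists
  refine ⟨∑ k ∈ Finset.range n,
    Polynomial.C ((cauchyPowerSeries g 0 (3 : NNReal)).coeff k) * Polynomial.X ^ k, fun z hz => ?_⟩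
  have hz' : z ∈ Metric.ball (0 : ℂ) ((2 : NNReal) : ℝ) := by
    rw [mem_closedBall_zero_iff] at hz
    rw [mem_ball_zero_iff]
    push_cast
    linarith
  have h := hn z hz'
  rw [zero_add, dist_comm, dist_eq_norm, FormalMultilinearSeries.partialSum] at h
  simp only [FormalMultilinearSeries.apply_eq_pow_smul_coeff, smul_eq_mul] at h
  simpa only [Polynomial.eval_finsetSum, Polynomial.eval_mul, Polynomial.eval_C,
    Polynomial.eval_pow, Polynomial.eval_X, mul_comm] using h

theorem Differentiable.exists_polynomial_norm_approx {g : ℂ → ℂ} (hg : Differentiable ℂ g)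
    (h0 : ∀ z, g z ≠ 0) {c : ℝ} (hc : 1 < c) :
    ∃ p : Polynomial ℂ, ∀ z ∈ Metric.closedBall (0 : ℂ) 1,
      ‖g z‖ ≤ c * ‖p.eval z‖ ∧ ‖p.eval z‖ ≤ c * ‖g z‖ := by
  obtain ⟨z₀, _, hmin⟩ := (isCompact_closedBall (0 : ℂ) 1).exists_isMinOn ⟨0, by simp⟩
    hg.continuous.norm.continuousOn
  have hm : 0 < ‖g z₀‖ := norm_pos_iff.2 (h0 z₀)
  have hc' : 0 < 1 - c⁻¹ := by
    have := inv_lt_one_of_one_lt₀ hc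
    linarith
  obtain ⟨p, hp⟩ := hg.exists_polynomial_approx (mul_pos hc' hm)
  refine ⟨p, fun z hz => ?_⟩
  have h1 : ‖p.eval z - g z‖ ≤ (1 - c⁻¹) * ‖g z‖ :=
    (hp z hz).le.trans (mul_le_mul_of_nonneg_left (hmin hz) hc'.le)
  have hcpos : 0 < c := by linarith
  constructor
  · have h2 := norm_sub_norm_le (g z) (p.eval z)
    rw [norm_sub_rev] at h2
    have h3 : c⁻¹ * ‖g z‖ ≤ ‖p.eval z‖ := by linarith
    rwa [inv_mul_le_iff₀ hcpos] at h3
  · have h2 := norm_sub_norm_le (p.eval z) (g z)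
    have h3 : 1 - c⁻¹ ≤ c - 1 := by
      have : 2 ≤ c + c⁻¹ := by
        have : c * c⁻¹ = 1 := mul_inv_cancel₀ hcpos.ne'
        nlinarith [sq_nonneg (c - c⁻¹), inv_pos.2 hcpos]
      linarith
    nlinarith [norm_nonneg (g z)]

/-- The isoperimetric inequality `4πA ≤ L²` for the metric `e^u |dz|²` with `u` subharmonic. -/
theorem four_pi_mul_integral_exp_le_of_laplacian_nonneg {u : ℂ → ℝ}
    (hc : ContinuousOn u (Metric.closedBall 0 1))
    (hu : ∀ z ∈ Metric.ball (0 : ℂ) 1, ContDiffAt ℝ 2 u z)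
    (hL : ∀ z ∈ Metric.ball (0 : ℂ) 1, 0 ≤ Laplacian.laplacian u z) :
    4 * π * ∫ z in Metric.ball (0 : ℂ) 1, Real.exp (u z) ≤
      (∫ θ in (0 : ℝ)..(2 * π), Real.exp (u (Complex.exp (θ * Complex.I)) / 2)) ^ 2 := by
  set L := ∫ θ in (0 : ℝ)..(2 * π), Real.exp (u (Complex.exp (θ * Complex.I)) / 2) with hLdef
  have hcircle : ∀ θ : ℝ, Complex.exp (θ * Complex.I) ∈ Metric.sphere (0 : ℂ) 1 := fun θ => by
    simp [Complex.norm_exp_ofReal_mul_I]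
  have huθ : Continuous fun θ : ℝ => u (Complex.exp (θ * Complex.I)) :=
    hc.comp_continuous (by fun_prop) fun θ => Metric.sphere_subset_closedBall (hcircle θ)
  have key : ∀ ε : ℝ, 0 < ε →
      4 * π * ∫ z in Metric.ball (0 : ℂ) 1, Real.exp (u z) ≤ Real.exp (11 * ε) * L ^ 2 := by
    intro ε hε
    obtain ⟨F, hF, hFu⟩ := exists_differentiable_re_approx
      (hc.mono Metric.sphere_subset_closedBall) hε
    let H : ℂ → ℝ := fun z => (F z + ε).re
    have hH : ∀ z, InnerProductSpace.HarmonicAt H z := fun z =>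
      AnalyticAt.harmonicAt_re ((hF.add_const (ε : ℂ)).analyticAt z)
    have hHre : ∀ z, H z = (F z).re + ε := fun z => by simp [H]
    have hle : ∀ z ∈ Metric.closedBall (0 : ℂ) 1, u z ≤ (F z).re + ε := by
      have hHc : Continuous H := by
        have := hF.continuous
        fun_prop
      have := nonpos_of_laplacian_nonneg (w := u - H) (hc.sub hHc.continuousOn)
        (fun z hz => (hu z hz).sub (hH z).1)
        (fun z hz => by
          have h0 : Laplacian.laplacian H z = 0 := (hH z).2.self_of_nhds
          rw [(hu z hz).laplacian_sub (hH z).1, h0, sub_zero]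
          exact hL z hz)
        (fun z hz => by
          have := (abs_lt.1 (hFu z hz)).2
          simp only [Pi.sub_apply, hHre]
          linarith)
      intro z hz
      have h := this z hz
      simp only [Pi.sub_apply, hHre] at h
      linarith
    have hg : Differentiable ℂ fun z => Complex.exp (F z / 4) := (hF.div_const 4).cexp
    obtain ⟨p, hp⟩ := hg.exists_polynomial_norm_approx (fun z => Complex.exp_ne_zero _)
      (Real.one_lt_exp_iff.2 hε)
    have hnorm : ∀ z, ‖Complex.exp (F z / 4)‖ = Real.exp ((F z).re / 4) := fun z => by
      rw [Complex.norm_exp]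
      congr 1
      exact Complex.div_ofNat_re (F z) 4
    simp only [hnorm] at hp
    have hball : ∀ z ∈ Metric.ball (0 : ℂ) 1,
        Real.exp (u z) ≤ Real.exp (5 * ε) * ‖p.eval z‖ ^ 4 := fun z hz => by
      have hz' := Metric.ball_subset_closedBall hz
      calc Real.exp (u z) ≤ Real.exp ((F z).re + ε) := Real.exp_le_exp.2 (hle z hz')
        _ = Real.exp ε * Real.exp ((F z).re / 4) ^ 4 := by
          rw [← Real.exp_nat_mul, ← Real.exp_add]; congr 1; push_cast; ring
        _ ≤ Real.exp ε * (Real.exp ε * ‖p.eval z‖) ^ 4 := by gcongr; exact (hp z hz').1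
        _ = Real.exp (5 * ε) * ‖p.eval z‖ ^ 4 := by
          rw [mul_pow, ← mul_assoc, ← Real.exp_nat_mul, ← Real.exp_add]
          congr 2; push_cast; ring
    have hsphere : ∀ z ∈ Metric.sphere (0 : ℂ) 1,
        ‖p.eval z‖ ^ 2 ≤ Real.exp (3 * ε) * Real.exp (u z / 2) := fun z hz => by
      have h1 := (abs_lt.1 (hFu z hz)).1
      calc ‖p.eval z‖ ^ 2 ≤ (Real.exp ε * Real.exp ((F z).re / 4)) ^ 2 := by
            gcongr; exact (hp z (Metric.sphere_subset_closedBall hz)).2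
        _ = Real.exp (2 * ε + (F z).re / 2) := by
          rw [← Real.exp_add, ← Real.exp_nat_mul]; congr 1; push_cast; ring
        _ ≤ Real.exp (3 * ε + u z / 2) := Real.exp_le_exp.2 (by linarith)
        _ = _ := Real.exp_add _ _
    have hI : ∫ z in Metric.ball (0 : ℂ) 1, Real.exp (u z) ≤
        Real.exp (5 * ε) * ∫ z in Metric.ball (0 : ℂ) 1, ‖p.eval z‖ ^ 4 := by
      rw [← integral_const_mul]
      have hint : ∀ f : ℂ → ℝ, ContinuousOn f (Metric.closedBall 0 1) →
          IntegrableOn f (Metric.ball 0 1) := fun f hf =>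
        (hf.integrableOn_compact (isCompact_closedBall 0 1)).mono_set Metric.ball_subset_closedBall
      exact setIntegral_mono_on (hint _ hc.rexp)
        (hint _ (Continuous.continuousOn (by fun_prop))) measurableSet_ball hball
    have hS : ∫ θ in (0 : ℝ)..(2 * π), ‖p.eval (Complex.exp (θ * Complex.I))‖ ^ 2 ≤
        Real.exp (3 * ε) * L := by
      rw [hLdef, ← intervalIntegral.integral_const_mul]
      exact intervalIntegral.integral_mono_on (by positivity)
        (Continuous.intervalIntegrable (by fun_prop) _ _)
        (((huθ.div_const 2).rexp.const_mul _).intervalIntegrable _ _) fun θ _ => hsphere _ (hcircle θ)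
    have hS0 : 0 ≤ ∫ θ in (0 : ℝ)..(2 * π), ‖p.eval (Complex.exp (θ * Complex.I))‖ ^ 2 :=
      intervalIntegral.integral_nonneg (by positivity) fun θ _ => by positivity
    calc 4 * π * ∫ z in Metric.ball (0 : ℂ) 1, Real.exp (u z)
        ≤ 4 * π * (Real.exp (5 * ε) * ∫ z in Metric.ball (0 : ℂ) 1, ‖p.eval z‖ ^ 4) := by gcongr
      _ = Real.exp (5 * ε) * (4 * π * ∫ z in Metric.ball (0 : ℂ) 1, ‖p.eval z‖ ^ 4) := by ring
      _ ≤ Real.exp (5 * ε) * (Real.exp (3 * ε) * L) ^ 2 := by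
        gcongr
        exact p.carleman.trans (by gcongr)
      _ = Real.exp (11 * ε) * L ^ 2 := by
        rw [mul_pow, ← mul_assoc, ← Real.exp_nat_mul, ← Real.exp_add]
        congr 2; push_cast; ring
  have hlim : Filter.Tendsto (fun ε : ℝ => Real.exp (11 * ε) * L ^ 2)
      (nhdsWithin 0 (Set.Ioi 0)) (nhds (L ^ 2)) := by
    have : Continuous fun ε : ℝ => Real.exp (11 * ε) * L ^ 2 := by fun_prop
    simpa using (this.tendsto 0).mono_left nhdsWithin_le_nhds
  exact ge_of_tendsto hlim (eventually_mem_nhdsWithin.mono fun ε hε => key ε hε)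

/-- Bol's isoperimetric inequality: if `Δu = V e^u` on the unit disk with `0 ≤ V ≤ λ`,
then `(∫_{∂B₁} e^{u/2} dσ)² ≥ (4π − (λ/2)∫_{B₁} e^u) ∫_{B₁} e^u`. -/
theorem bol_inequality (u V : ℂ → ℝ) (lam : ℝ) (hlam : 0 ≤ lam)
    (hu : ContDiffOn ℝ 2 u (Metric.closedBall (0 : ℂ) 1))
    (hV : ∀ z ∈ Metric.ball (0 : ℂ) 1, 0 ≤ V z ∧ V z ≤ lam)
    (heq : ∀ z ∈ Metric.ball (0 : ℂ) 1, lap2 u z = V z * Real.exp (u z)) :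
    (4 * π - lam / 2 * ∫ z in Metric.ball (0 : ℂ) 1, Real.exp (u z)) *
        (∫ z in Metric.ball (0 : ℂ) 1, Real.exp (u z)) ≤
      (∫ θ in (0 : ℝ)..(2 * π), Real.exp (u (Complex.exp (θ * Complex.I)) / 2)) ^ 2 := by
  have hcd : ∀ z ∈ Metric.ball (0 : ℂ) 1, ContDiffAt ℝ 2 u z := fun z hz =>
    hu.contDiffAt (Filter.mem_of_superset (Metric.isOpen_ball.mem_nhds hz)
      Metric.ball_subset_closedBall)
  refine le_trans ?_ (four_pi_mul_integral_exp_le_of_laplacian_nonneg hu.continuousOn hcd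
    fun z hz => ?_)
  · rw [sub_mul, sub_le_self_iff, mul_assoc]
    exact mul_nonneg (by positivity) (mul_self_nonneg _)
  · rw [← (hcd z hz).lap2_eq_laplacian, heq z hz]
    exact mul_nonneg (hV z hz).1 (Real.exp_pos _).le
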